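/- Let k ≥ 2 and b be positive integers, let γ > 0, and let S = ((x_1, y_1), …, (x_m, y_m)) be a finite training set with x_i ∈ ℝ^b and labels y_i ∈ {1, …, k}. Let f, g : ℝ^b → ℝ^k satisfy ‖f(x_i) − g(x_i)‖₂ ≤ γ/√2 for every i. Then (1/m)·#{i : g(x_i)[y_i] ≤ max_{j ≠ y_i} g(x_i)[j]} ≤ (1/m)·#{i : f(x_i)[y_i] ≤ γ + max_{j ≠ y_i} f(x_i)[j]}, i.e. the empirical classification loss of g is at most the empirical margin loss of f at margin γ. -/

import Mathlib

open Finset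

theorem EuclideanSpace.sub_apply_le_sqrt_two_mul_norm {ι : Type*} [Fintype ι]
    (v : EuclideanSpace ℝ ι) {a b : ι} (hab : a ≠ b) : v a - v b ≤ √2 * ‖v‖ := by
  classical
  have hpair : v a ^ 2 + v b ^ 2 ≤ ‖v‖ ^ 2 := by
    rw [EuclideanSpace.real_norm_sq_eq, ← Finset.sum_pair (f := fun i => v i ^ 2) hab]
    exact Finset.sum_le_sum_of_subset_of_nonneg (Finset.subset_univ _)
      fun i _ _ => sq_nonneg (v i)
  refine le_of_abs_le (abs_le_of_sq_le_sq ?_ (by positivity))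
  rw [mul_pow, Real.sq_sqrt zero_le_two]
  nlinarith [sq_nonneg (v a + v b)]

/-- If the coordinate `a` of `v` does not exceed the largest of the others, then the same holds
with slack `γ` for every `u` within Euclidean distance `γ / √2` of `v`. -/
theorem EuclideanSpace.apply_le_add_iSup_of_norm_sub_le {ι : Type*} [Fintype ι] [Nontrivial ι]
    {u v : EuclideanSpace ℝ ι} {γ : ℝ} (huv : ‖u - v‖ ≤ γ / √2) {a : ι}
    (hv : v a ≤ ⨆ j : {j : ι // j ≠ a}, v j) : u a ≤ γ + ⨆ j : {j : ι // j ≠ a}, u j := by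
  obtain ⟨c, hc⟩ := exists_ne a
  have : Nonempty {j : ι // j ≠ a} := ⟨⟨c, hc⟩⟩
  obtain ⟨j, hj⟩ := exists_eq_ciSup_of_finite (f := fun j : {j : ι // j ≠ a} => v j)
  have hu : u j ≤ ⨆ j : {j : ι // j ≠ a}, u j :=
    le_ciSup (f := fun j : {j : ι // j ≠ a} => u j) (Set.finite_range _).bddAbove j
  have hd := sub_apply_le_sqrt_two_mul_norm (u - v) j.2.symm
  have hγ : √2 * ‖u - v‖ ≤ γ := by
    rwa [le_div_iff₀ (by positivity), mul_comm] at huv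
  simp only [PiLp.sub_apply] at hd
  simp only at hj
  linarith

open Classical in
/-- **Lemma 6 (deterministic core).** If the outputs of `g` are within `γ/√2` of those of `f`
(in Euclidean norm) on every training point, then the empirical classification loss of `g`
is at most the empirical margin loss of `f` at margin `γ`. -/
theorem classification_loss_le_margin_loss
    (k b m : ℕ) (hk : 2 ≤ k) (hm : 0 < m) (γ : ℝ) (hγ : 0 < γ)
    (x : Fin m → (Fin b → ℝ)) (y : Fin m → Fin k)
    (f g : (Fin b → ℝ) → EuclideanSpace ℝ (Fin k))
    (hfg : ∀ i, ‖f (x i) - g (x i)‖ ≤ γ / Real.sqrt 2) :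
    ((univ.filter fun i : Fin m =>
        g (x i) (y i) ≤ ⨆ j : {j : Fin k // j ≠ y i}, g (x i) j).card : ℝ) / m ≤
      ((univ.filter fun i : Fin m =>
        f (x i) (y i) ≤ γ + ⨆ j : {j : Fin k // j ≠ y i}, f (x i) j).card : ℝ) / m := by
  have : Nontrivial (Fin k) := Fin.nontrivial_iff_two_le.mpr hk
  refine div_le_div_of_nonneg_right (Nat.cast_le.mpr (card_le_card ?_)) m.cast_nonneg
  refine monotone_filter_right _ fun i _ => ?_
  exact EuclideanSpace.apply_le_add_iSup_of_norm_sub_le (hfg i)
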